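/- arXiv:2605.26745 — 2 statements merged into one kernel-verified Lean document; each statement's English description precedes it below -/
import Mathlib

section
/- Let d ≥ 1, let α > 0, and let g : ℝ → ℝ be differentiable. Define u : (Fin d → ℝ) × ℝ → ℝ by u(x,t) = 1 / (1 + exp((Σ_{i=1}^d x_i − (d/2) g(t)) / (2α))). Then u satisfies the variable-speed d-dimensional Burgers' equation ∂u/∂t = g'(t) (α Σ_{i=1}^d ∂²u/∂x_i² − u Σ_{i=1}^d ∂u/∂x_i) at every point (x,t). -/
/-- The decreasing logistic profile `z ↦ 1 / (1 + exp z)`. -/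
noncomputable def logisticProfile (z : ℝ) : ℝ := 1 / (1 + Real.exp z)

theorem hasDerivAt_logisticProfile (z : ℝ) :
    HasDerivAt logisticProfile (logisticProfile z ^ 2 - logisticProfile z) z := by
  have hpos : 1 + Real.exp z ≠ 0 := by positivity
  have h := ((Real.hasDerivAt_exp z).const_add 1).inv hpos
  have hfun : logisticProfile = (fun y => 1 + Real.exp y)⁻¹ := by
    ext y
    simp [logisticProfile]
  rw [hfun]
  refine h.congr_deriv ?_
  simp only [Pi.inv_apply]
  field_simp
  ring

theorem deriv_logisticProfile_comp_affine (a c : ℝ) :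
    deriv (fun s => logisticProfile ((s + c) / a))
      = fun s => (logisticProfile ((s + c) / a) ^ 2 - logisticProfile ((s + c) / a)) * (1 / a) := by
  ext s
  exact ((hasDerivAt_logisticProfile _).comp s
    (((hasDerivAt_id s).add_const c).div_const a)).deriv

theorem deriv_deriv_logisticProfile_comp_affine (a c s : ℝ) :
    deriv (deriv (fun s => logisticProfile ((s + c) / a))) s
      = (2 * logisticProfile ((s + c) / a) - 1)
        * (logisticProfile ((s + c) / a) ^ 2 - logisticProfile ((s + c) / a)) * (1 / a) ^ 2 := by
  rw [deriv_logisticProfile_comp_affine]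
  have h : HasDerivAt (fun s => logisticProfile ((s + c) / a)) _ s :=
    (hasDerivAt_logisticProfile _).comp s (((hasDerivAt_id s).add_const c).div_const a)
  refine (((h.pow 2).sub h).mul_const (1 / a)).deriv.trans ?_
  push_cast
  ring

/-- For `α > 0` and a differentiable speed law `g : ℝ → ℝ`, the function
`u (x, t) = 1 / (1 + exp ((∑ i, x i − (d/2) g t) / (2α)))` satisfies the variable-speed
`d`-dimensional Burgers' equation
`∂u/∂t = g' t (α ∑ i ∂²u/∂x_i² − u ∑ i ∂u/∂x_i)` at every point. -/
theorem stmt_7 (d : ℕ) (hd : 1 ≤ d) (α : ℝ) (hα : 0 < α)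
    (g : ℝ → ℝ) (hg : Differentiable ℝ g)
    (u : (Fin d → ℝ) × ℝ → ℝ)
    (hu : ∀ (x : Fin d → ℝ) (t : ℝ),
      u (x, t) = 1 / (1 + Real.exp (((∑ i, x i) - (d / 2 : ℝ) * g t) / (2 * α)))) :
    ∀ (x : Fin d → ℝ) (t : ℝ),
      deriv (fun τ => u (x, τ)) t
        = deriv g t *
            (α * ∑ i, deriv (deriv (fun s => u (Function.update x i s, t))) (x i)
              - u (x, t) * ∑ i, deriv (fun s => u (Function.update x i s, t)) (x i)) := by
  intro x t
  have hprofile : ∀ (y : Fin d → ℝ) (τ : ℝ),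
      u (y, τ) = logisticProfile (((∑ i, y i) - (d / 2 : ℝ) * g τ) / (2 * α)) := hu
  have hslice : ∀ i : Fin d, (fun s => u (Function.update x i s, t)) = fun s =>
      logisticProfile ((s + ((∑ j, x j) - x i - (d / 2 : ℝ) * g t)) / (2 * α)) := by
    intro i
    ext s
    rw [hprofile, Finset.sum_update_of_mem (Finset.mem_univ i),
      ← Finset.add_sum_erase Finset.univ x (Finset.mem_univ i), Finset.sdiff_singleton_eq_erase]
    congr 2
    ring
  have harg : ∀ i : Fin d, x i + ((∑ j, x j) - x i - (d / 2 : ℝ) * g t)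
      = (∑ j, x j) - (d / 2 : ℝ) * g t := fun i => by ring
  have htime : HasDerivAt (fun τ =>
      logisticProfile (((∑ i, x i) - (d / 2 : ℝ) * g τ) / (2 * α))) _ t :=
    (hasDerivAt_logisticProfile _).comp t
      ((((hg t).hasDerivAt.const_mul (d / 2 : ℝ)).const_sub (∑ i, x i)).div_const (2 * α))
  simp only [hslice, deriv_deriv_logisticProfile_comp_affine]
  simp only [deriv_logisticProfile_comp_affine, harg, hprofile, htime.deriv, Finset.sum_const,
    Finset.card_univ, Fintype.card_fin, nsmul_eq_mul]
  field_simp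
  ring
end

section
/- Let d ≥ 1, let Φ : (Fin d → ℝ) → ℝ be twice differentiable, let D > 0, let m : ℝ → ℝ be differentiable, and let 𝟙 ∈ (Fin d → ℝ) denote the all-ones vector. Define u(x,t) = exp(−Φ(x − m(t)𝟙)/D) and the drift field f(x,t) = −∇Φ(x − m(t)𝟙) + m'(t)𝟙. Then u satisfies the Fokker–Planck equation ∂u/∂t(x,t) = −Σ_{i=1}^d ∂/∂x_i ( f_i(x,t) u(x,t) ) + D Σ_{i=1}^d ∂²u/∂x_i²(x,t) at every point (x,t). -/
/-- The chain rule for `exp (-Φ / D)` along a differentiable curve. -/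
theorem hasDerivAt_exp_neg_div_comp {E : Type*} [NormedAddCommGroup E] [NormedSpace ℝ E]
    {Φ : E → ℝ} (hΦ : Differentiable ℝ Φ) (D : ℝ) {p : ℝ → E} {v : E} {s : ℝ}
    (hp : HasDerivAt p v s) :
    HasDerivAt (fun s => Real.exp (-Φ (p s) / D))
      (Real.exp (-Φ (p s) / D) * (-(fderiv ℝ Φ (p s) v) / D)) s :=
  (((hΦ (p s)).hasFDerivAt.comp_hasDerivAt s hp).neg.div_const D).exp

/-- A coordinate line, translated by a constant multiple of the all-ones vector, has the
coordinate vector as its derivative. -/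
theorem hasDerivAt_update_sub_const {d : ℕ} (x : Fin d → ℝ) (c : ℝ) (i : Fin d) (s : ℝ) :
    HasDerivAt (fun s => fun j => Function.update x i s j - c) (Pi.single i (1 : ℝ)) s :=
  (hasDerivAt_update x i s).sub_const (fun _ => c)

/-- The `i`-th partial derivative is the Fréchet derivative applied to a coordinate vector. -/
theorem deriv_comp_update {d : ℕ} {Φ : (Fin d → ℝ) → ℝ} (hΦ : Differentiable ℝ Φ)
    (y : Fin d → ℝ) (i : Fin d) :
    deriv (fun s => Φ (Function.update y i s)) (y i) = fderiv ℝ Φ y (Pi.single i 1) := by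
  have h := (hΦ (Function.update y i (y i))).hasFDerivAt.comp_hasDerivAt (y i)
    (hasDerivAt_update y i (y i))
  rw [Function.update_eq_self] at h
  exact h.deriv

/-- The contribution of one coordinate to the right-hand side of the Fokker–Planck equation
for `exp (-Φ (x - c) / D)` and the drift `-∇Φ (x - c) + a`. -/
theorem neg_deriv_drift_add_diffusion {d : ℕ} {Φ : (Fin d → ℝ) → ℝ} (hΦ : Differentiable ℝ Φ)
    (hΦ' : Differentiable ℝ (fderiv ℝ Φ)) {D : ℝ} (hD : D ≠ 0) (a c : ℝ) (x : Fin d → ℝ)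
    (i : Fin d) :
    -deriv (fun s => (-(fderiv ℝ Φ (fun j => Function.update x i s j - c) (Pi.single i 1)) + a)
          * Real.exp (-Φ (fun j => Function.update x i s j - c) / D)) (x i)
        + D * deriv (deriv fun s => Real.exp (-Φ (fun j => Function.update x i s j - c) / D))
          (x i)
      = a * Real.exp (-Φ (fun j => x j - c) / D) / D
          * fderiv ℝ Φ (fun j => x j - c) (Pi.single i 1) := by
  have hp := hasDerivAt_update_sub_const x c i
  have hU := fun s => hasDerivAt_exp_neg_div_comp hΦ D (hp s)
  have hg := ((hΦ' _).hasFDerivAt.comp_hasDerivAt (x i) (hp (x i))).clm_apply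
    (hasDerivAt_const (x i) (Pi.single i (1 : ℝ) : Fin d → ℝ))
  rw [funext fun s => (hU s).deriv]
  have h1 := ((hg.neg.add_const a).mul (hU (x i))).deriv
  have h2 := ((hU (x i)).mul (hg.neg.div_const D)).deriv
  simp only [Pi.mul_def, Pi.neg_def, Function.comp_def] at h1 h2
  rw [h1, h2]
  simp only [Function.update_eq_self]
  field_simp
  ring

/-- Let `Φ : ℝ^d → ℝ` be twice differentiable, `D > 0`, `m : ℝ → ℝ`
differentiable, and let `𝟙` be the all-ones vector.  Define
`u (x, t) = exp (−Φ (x − m t 𝟙) / D)` and the drift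
`f (x, t) = −∇Φ (x − m t 𝟙) + m' t 𝟙`.  Then `u` satisfies the Fokker–Planck equation
`∂u/∂t = −∑ i ∂/∂x_i (f_i u) + D ∑ i ∂²u/∂x_i²` at every point `(x, t)`. -/
theorem stmt_11 (d : ℕ) (hd : 1 ≤ d)
    (Φ : (Fin d → ℝ) → ℝ)
    (hΦ : Differentiable ℝ Φ) (hΦ' : Differentiable ℝ (fderiv ℝ Φ))
    (D : ℝ) (hD : 0 < D)
    (m : ℝ → ℝ) (hm : Differentiable ℝ m)
    (u : (Fin d → ℝ) × ℝ → ℝ)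
    (hu : ∀ (x : Fin d → ℝ) (t : ℝ),
      u (x, t) = Real.exp (-Φ (fun j => x j - m t) / D))
    (f : (Fin d → ℝ) × ℝ → (Fin d → ℝ))
    (hf : ∀ (x : Fin d → ℝ) (t : ℝ) (i : Fin d),
      f (x, t) i
        = -(deriv (fun s => Φ (Function.update (fun j => x j - m t) i s)) (x i - m t))
          + deriv m t) :
    ∀ (x : Fin d → ℝ) (t : ℝ),
      deriv (fun τ => u (x, τ)) t
        = -(∑ i, deriv
              (fun s => f (Function.update x i s, t) i * u (Function.update x i s, t))
              (x i))
          + D * ∑ i, deriv (deriv (fun s => u (Function.update x i s, t))) (x i) := by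
  intro x t
  have hf' : ∀ (z : Fin d → ℝ) (i : Fin d),
      f (z, t) i = -(fderiv ℝ Φ (fun j => z j - m t) (Pi.single i 1)) + deriv m t := by
    intro z i
    rw [hf, ← deriv_comp_update hΦ]
  have hp : HasDerivAt (fun τ => fun j => x j - m τ) (fun _ : Fin d => -deriv m t) t :=
    hasDerivAt_pi.2 fun j => (hm t).hasDerivAt.const_sub (x j)
  have hsum : (fun _ : Fin d => -deriv m t)
      = ∑ i, (-deriv m t) • (Pi.single i (1 : ℝ) : Fin d → ℝ) := by
    ext j
    simp [Finset.sum_apply, Pi.single_apply]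
  simp only [hu, hf']
  rw [(hasDerivAt_exp_neg_div_comp hΦ D hp).deriv, Finset.mul_sum, ← Finset.sum_neg_distrib,
    ← Finset.sum_add_distrib]
  simp only [neg_deriv_drift_add_diffusion hΦ hΦ' hD.ne']
  rw [hsum, map_sum, ← Finset.mul_sum]
  simp only [map_smul, smul_eq_mul]
  rw [← Finset.mul_sum]
  ring
end
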